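/- Let γ₋, γ₊, Ω ∈ ℝ with Ω > 0 and γ₀ := γ₋ − γ₊ ≠ 0, and let n₀ ∈ ℝ. Define D(t) := exp( (γ₀/(2Ω))·(cos(Ω t) − 1) ) and N(t) := (n₀ − γ₊/γ₀)·D(t)² + γ₊/γ₀. Then N(0) = n₀, and for every t ∈ ℝ the function N is differentiable at t with N'(t) = −γ₋ sin(Ω t)·N(t) + γ₊ sin(Ω t)·(N(t) + 1). -/

import Mathlib

/-- With `D(t) = exp((γ₀/(2Ω))(cos(Ωt) − 1))` and `γ₀ = γminus − γplus ≠ 0`,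
the function `N(t) = (n₀ − γplus/γ₀)·D(t)² + γplus/γ₀` satisfies `N(0) = n₀` and the
mean-occupation-number equation of motion
`N'(t) = −γminus sin(Ωt)·N(t) + γplus sin(Ωt)·(N(t) + 1)`. -/
theorem damped_oscillator_occupation_number
    (γminus γplus Ω n₀ : ℝ) (hΩ : 0 < Ω) (hγ₀ : γminus - γplus ≠ 0)
    (D N : ℝ → ℝ)
    (hD : ∀ t, D t = Real.exp (((γminus - γplus) / (2 * Ω)) * (Real.cos (Ω * t) - 1)))
    (hN : ∀ t, N t = (n₀ - γplus / (γminus - γplus)) * (D t)^2 + γplus / (γminus - γplus)) :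
    N 0 = n₀ ∧
    (∀ t, HasDerivAt N
      (-γminus * Real.sin (Ω * t) * N t + γplus * Real.sin (Ω * t) * (N t + 1)) t) := by
  have hD' : ∀ t, HasDerivAt D (-((γminus - γplus) / 2) * Real.sin (Ω * t) * D t) t := by
    intro t
    have hlin : HasDerivAt (fun s : ℝ => Ω * s) Ω t := by
      simpa using (hasDerivAt_id t).const_mul Ω
    have hexp := ((hlin.cos.sub_const 1).const_mul ((γminus - γplus) / (2 * Ω))).exp
    rw [funext hD]
    refine hexp.congr_deriv ?_
    field_simp
  refine ⟨by simp [hN, hD], fun t => ?_⟩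
  have hN' := (((hD' t).pow 2).const_mul (n₀ - γplus / (γminus - γplus))).add_const
    (γplus / (γminus - γplus))
  have hN_eq : N = fun t => (n₀ - γplus / (γminus - γplus)) * (D ^ 2) t
      + γplus / (γminus - γplus) := funext hN
  rw [hN t, hN_eq]
  refine hN'.congr_deriv ?_
  field_simp
  ring
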